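/- arXiv:2508.13778 — 3 statements merged into one kernel-verified Lean document; each statement's English description precedes it below -/
import Mathlib

section
/- There exists an integer ℓ₀ ≥ 2 such that for every integer ℓ ≥ ℓ₀ and every finite subset S ⊆ ℤ² that is connected in the king graph and not small (i.e. |S| ≥ 5), one has |π_ℓ(S)| ≤ |S|/(1 + η), where η = 1/101. -/
/-- King-graph adjacency on `ℤ²`: distinct points at `ℓ∞`-distance at most 1. -/
def kingAdj (x y : ℤ × ℤ) : Prop :=
  x ≠ y ∧ max |x.1 - y.1| |x.2 - y.2| ≤ 1

/-- A finite set `S ⊆ ℤ²` is connected in the king graph: any two of its points are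
joined by a path staying inside `S`. -/
def kingConnected (S : Finset (ℤ × ℤ)) : Prop :=
  ∀ x ∈ S, ∀ y ∈ S,
    Relation.ReflTransGen (fun a b => a ∈ S ∧ b ∈ S ∧ kingAdj a b) x y

/-- The block projection `π_ℓ : ℤ² → ℤ²`, `x ↦ (⌊x₁/ℓ⌋, ⌊x₂/ℓ⌋)`. -/
def blockProj (ℓ : ℤ) (x : ℤ × ℤ) : ℤ × ℤ :=
  (Int.fdiv x.1 ℓ, Int.fdiv x.2 ℓ)

namespace KingAux

/-- closed king neighbourhood of a point -/
noncomputable def nb (p : ℤ × ℤ) : Finset (ℤ × ℤ) :=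
  Finset.Icc (p.1 - 1) (p.1 + 1) ×ˢ Finset.Icc (p.2 - 1) (p.2 + 1)

/-- closed king neighbourhood of a set -/
noncomputable def nbs (U : Finset (ℤ × ℤ)) : Finset (ℤ × ℤ) := U.biUnion nb

/-- adjacency within a set -/
def rel (S : Finset (ℤ × ℤ)) (a b : ℤ × ℤ) : Prop := a ∈ S ∧ b ∈ S ∧ kingAdj a b

lemma adj_bounds {a b : ℤ × ℤ} (h : kingAdj a b) :
    a.1 - 1 ≤ b.1 ∧ b.1 ≤ a.1 + 1 ∧ a.2 - 1 ≤ b.2 ∧ b.2 ≤ a.2 + 1 := by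
  obtain ⟨-, h⟩ := h
  rw [max_le_iff, abs_le, abs_le] at h
  omega

lemma mem_nb {a b : ℤ × ℤ} (h : kingAdj a b) : b ∈ nb a := by
  have := adj_bounds h
  simp only [nb, Finset.mem_product, Finset.mem_Icc]
  omega

lemma self_mem_nb (a : ℤ × ℤ) : a ∈ nb a := by
  simp only [nb, Finset.mem_product, Finset.mem_Icc]
  omega

lemma subset_nbs (U : Finset (ℤ × ℤ)) : U ⊆ nbs U := fun x hx =>
  Finset.mem_biUnion.2 ⟨x, hx, self_mem_nb x⟩

lemma card_nb (a : ℤ × ℤ) : (nb a).card = 9 := by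
  have h1 : (a.1 + 1 + 1 - (a.1 - 1)).toNat = 3 := by omega
  have h2 : (a.2 + 1 + 1 - (a.2 - 1)).toNat = 3 := by omega
  simp only [nb, Finset.card_product, Int.card_Icc, h1, h2]

lemma card_nb_sdiff {a b : ℤ × ℤ} (h : kingAdj a b) : (nb b \ nb a).card ≤ 5 := by
  have hb := adj_bounds h
  have h4 : 4 ≤ (nb a ∩ nb b).card := by
    have hsub : Finset.Icc (max (a.1 - 1) (b.1 - 1)) (min (a.1 + 1) (b.1 + 1)) ×ˢ
        Finset.Icc (max (a.2 - 1) (b.2 - 1)) (min (a.2 + 1) (b.2 + 1)) ⊆ nb a ∩ nb b := by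
      intro x hx
      simp only [nb, Finset.mem_inter, Finset.mem_product, Finset.mem_Icc] at hx ⊢
      omega
    refine le_trans ?_ (Finset.card_le_card hsub)
    simp only [Finset.card_product, Int.card_Icc]
    have h1 : 2 ≤ (min (a.1 + 1) (b.1 + 1) + 1 - max (a.1 - 1) (b.1 - 1)).toNat := by omega
    have h2 : 2 ≤ (min (a.2 + 1) (b.2 + 1) + 1 - max (a.2 - 1) (b.2 - 1)).toNat := by omega
    exact Nat.mul_le_mul h1 h2
  have := Finset.card_sdiff (s := nb a) (t := nb b)
  rw [card_nb] at this
  omega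

lemma crossing {R : ℤ × ℤ → ℤ × ℤ → Prop} {P : Finset (ℤ × ℤ)} {z y : ℤ × ℤ}
    (h : Relation.ReflTransGen R z y) (hz : z ∈ P) (hy : y ∉ P) :
    ∃ a b, a ∈ P ∧ b ∉ P ∧ R a b := by
  induction h with
  | refl => exact absurd hz hy
  | @tail b c _ hbc ih =>
    by_cases hb : b ∈ P
    · exact ⟨b, c, hb, hy, hbc⟩
    · exact ih hb

/-- growing a connected set from `z` inside its component -/
lemma grow {L T : Finset (ℤ × ℤ)} {z : ℤ × ℤ} (hz : z ∈ L)
    (hT : ∀ x, x ∈ T ↔ x ∈ L ∧ Relation.ReflTransGen (rel L) z x) (k : ℕ) :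
    k + 1 ≤ T.card → ∃ P ⊆ T, z ∈ P ∧ P.card = k + 1 ∧ (nbs P).card ≤ 9 + 5 * k ∧
      ∃ a b : ℤ, ∀ p ∈ P, a ≤ p.1 ∧ p.1 ≤ a + k ∧ b ≤ p.2 ∧ p.2 ≤ b + k := by
  induction k with
  | zero =>
    intro _
    refine ⟨{z}, ?_, by simp, by simp, by simp [nbs, card_nb], z.1, z.2, by simp⟩
    simpa using (hT z).2 ⟨hz, .refl⟩
  | succ k ih =>
    intro hk
    obtain ⟨P, hPT, hzP, hc, hn, a, b, hab⟩ := ih (by omega)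
    obtain ⟨y, hyT, hyP⟩ := Finset.exists_mem_notMem_of_card_lt_card
      (show P.card < T.card by omega)
    obtain ⟨p, w, hp, hw, hpw⟩ := crossing ((hT y).1 hyT).2 hzP hyP
    refine ⟨insert w P, ?_, by simp [hzP], by rw [Finset.card_insert_of_notMem hw, hc], ?_, ?_⟩
    · refine Finset.insert_subset ?_ hPT
      exact (hT w).2 ⟨hpw.2.1, ((hT p).1 (hPT hp)).2.tail hpw⟩
    · have hsub : nbs (insert w P) ⊆ nbs P ∪ (nb w \ nb p) := by
        intro x hx
        simp only [nbs, Finset.mem_biUnion, Finset.mem_insert, Finset.mem_union,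
          Finset.mem_sdiff] at hx ⊢
        obtain ⟨q, rfl | hq, hxq⟩ := hx
        · by_cases hxp : x ∈ nb p
          · exact .inl ⟨p, hp, hxp⟩
          · exact .inr ⟨hxq, hxp⟩
        · exact .inl ⟨q, hq, hxq⟩
      have h1 := Finset.card_le_card hsub
      have h2 := Finset.card_union_le (nbs P) (nb w \ nb p)
      have h3 := card_nb_sdiff hpw.2.2
      omega
    · have hpb := hab p hp
      have hwb := adj_bounds hpw.2.2
      refine ⟨min a w.1, min b w.2, ?_⟩
      intro q hq
      push_cast
      rcases Finset.mem_insert.1 hq with rfl | hq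
      · omega
      · have := hab q hq
        by_cases h1 : a ≤ w.1 <;> by_cases h2 : b ≤ w.2 <;> omega

lemma card_proj {ℓ : ℤ} (hℓ : 4 ≤ ℓ) {P : Finset (ℤ × ℤ)} {a b : ℤ}
    (h : ∀ p ∈ P, a ≤ p.1 ∧ p.1 ≤ a + 4 ∧ b ≤ p.2 ∧ p.2 ≤ b + 4) :
    (P.image (blockProj ℓ)).card ≤ 4 := by
  have key : ∀ a x : ℤ, a ≤ x → x ≤ a + 4 → a / ℓ ≤ x / ℓ ∧ x / ℓ ≤ a / ℓ + 1 := by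
    intro a x h1 h2
    refine ⟨Int.ediv_le_ediv (by omega) h1, ?_⟩
    have e : (a + ℓ) / ℓ = a / ℓ + 1 := by
      rw [Int.add_ediv_of_dvd_right (dvd_refl ℓ), Int.ediv_self (by omega)]
    rw [← e]
    exact Int.ediv_le_ediv (by omega) (by omega)
  have hsub : P.image (blockProj ℓ) ⊆
      Finset.Icc (a / ℓ) (a / ℓ + 1) ×ˢ Finset.Icc (b / ℓ) (b / ℓ + 1) := by
    intro y hy
    obtain ⟨p, hp, rfl⟩ := Finset.mem_image.1 hy
    obtain ⟨h1, h2, h3, h4⟩ := h p hp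
    simp only [blockProj, Finset.mem_product, Finset.mem_Icc,
      Int.fdiv_eq_ediv_of_nonneg _ (show 0 ≤ ℓ by omega)]
    exact ⟨key _ _ h1 h2, key _ _ h3 h4⟩
  refine (Finset.card_le_card hsub).trans ?_
  have h1 : (a / ℓ + 1 + 1 - a / ℓ).toNat = 2 := by omega
  have h2 : (b / ℓ + 1 + 1 - b / ℓ).toNat = 2 := by omega
  simp only [Finset.card_product, Int.card_Icc, h1, h2]
  norm_num

lemma good_exists {ℓ : ℤ} (hℓ : 4 ≤ ℓ) {L T : Finset (ℤ × ℤ)} {z : ℤ × ℤ} (hz : z ∈ L)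
    (hT : ∀ x, x ∈ T ↔ x ∈ L ∧ Relation.ReflTransGen (rel L) z x) (h5 : 5 ≤ T.card) :
    ∃ P ⊆ L, P.card = 5 ∧ (nbs P).card ≤ 29 ∧ (P.image (blockProj ℓ)).card ≤ 4 := by
  obtain ⟨P, hP, -, hc, hn, a, b, hab⟩ := grow hz hT 4 h5
  exact ⟨P, fun x hx => ((hT x).1 (hP hx)).1, hc, hn, card_proj hℓ (by exact_mod_cast hab)⟩

/-- a packing of `k` good pieces -/
def Packed (ℓ : ℤ) (S : Finset (ℤ × ℤ)) (k : ℕ) : Prop :=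
  ∃ U ⊆ S, U.card = 5 * k ∧ (nbs U).card ≤ 29 * k ∧ (U.image (blockProj ℓ)).card ≤ 4 * k

lemma reach {S U : Finset (ℤ × ℤ)} {u x : ℤ × ℤ} (hu : u ∈ U)
    (h : Relation.ReflTransGen (rel S) u x) (hx : x ∉ U) :
    ∃ z ∈ nbs U \ U, z ∈ S \ U ∧ Relation.ReflTransGen (rel (S \ U)) z x := by
  induction h with
  | refl => exact absurd hu hx
  | @tail b c _ hbc ih =>
    have hc : c ∈ S \ U := Finset.mem_sdiff.2 ⟨hbc.2.1, hx⟩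
    by_cases hb : b ∈ U
    · exact ⟨c, Finset.mem_sdiff.2 ⟨Finset.mem_biUnion.2 ⟨b, hb, mem_nb hbc.2.2⟩, hx⟩, hc, .refl⟩
    · obtain ⟨z, h1, h2, h3⟩ := ih hb
      exact ⟨z, h1, h2, h3.tail ⟨Finset.mem_sdiff.2 ⟨hbc.1, hb⟩, hc, hbc.2.2⟩⟩

lemma main {ℓ : ℤ} (hℓ : 4 ≤ ℓ) {S : Finset (ℤ × ℤ)} (hS : kingConnected S) (h5 : 5 ≤ S.card) :
    102 * (S.image (blockProj ℓ)).card ≤ 101 * S.card := by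
  classical
  have hex : ∃ k, Packed ℓ S k ∧ ¬ Packed ℓ S (k + 1) := by
    by_contra! hcon
    have hall : ∀ k, Packed ℓ S k := by
      intro k
      induction k with
      | zero => exact ⟨∅, by simp, by simp, by simp [nbs], by simp⟩
      | succ k ih => exact hcon k ih
    obtain ⟨U, hU, hc, -⟩ := hall (S.card + 1)
    have := Finset.card_le_card hU
    omega
  obtain ⟨k, ⟨U, hU, hc, hn, hp⟩, hmax⟩ := hex
  have hno : ∀ P ⊆ S \ U, P.card = 5 → (nbs P).card ≤ 29 →
      (P.image (blockProj ℓ)).card ≤ 4 → False := by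
    intro P hP h1 h2 h3
    apply hmax
    have hdis : Disjoint U P :=
      Finset.disjoint_left.2 fun x hx hx' => (Finset.mem_sdiff.1 (hP hx')).2 hx
    refine ⟨U ∪ P, Finset.union_subset hU (hP.trans Finset.sdiff_subset), ?_, ?_, ?_⟩
    · rw [Finset.card_union_of_disjoint hdis]; omega
    · have : nbs (U ∪ P) = nbs U ∪ nbs P := Finset.union_biUnion
      rw [this]
      have := Finset.card_union_le (nbs U) (nbs P)
      omega
    · rw [Finset.image_union]
      have := Finset.card_union_le (U.image (blockProj ℓ)) (P.image (blockProj ℓ))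
      omega
  let comp : ℤ × ℤ → Finset (ℤ × ℤ) := fun z =>
    (S \ U).filter fun x => Relation.ReflTransGen (rel (S \ U)) z x
  have hcomp : ∀ z ∈ S \ U, (comp z).card ≤ 4 := by
    intro z hz
    by_contra! hlt
    obtain ⟨P, h1, h2, h3, h4⟩ := good_exists hℓ hz (T := comp z) (by simp [comp]) hlt
    exact hno P h1 h2 h3 h4
  have hk : 1 ≤ k := by
    by_contra! hk
    have hU0 : U = ∅ := Finset.card_eq_zero.1 (by omega)
    subst hU0
    obtain ⟨z, hz⟩ : S.Nonempty := Finset.card_pos.1 (by omega)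
    obtain ⟨P, h1, h2, h3, h4⟩ := good_exists hℓ hz (T := S)
      (fun x => ⟨fun hx => ⟨hx, hS z hz x hx⟩, fun h => h.1⟩) h5
    exact hno P (by simpa using h1) h2 h3 h4
  obtain ⟨u, hu⟩ : U.Nonempty := Finset.card_pos.1 (by omega)
  have hL : (S \ U).card ≤ 96 * k := by
    have hsub : S \ U ⊆ ((nbs U \ U) ∩ (S \ U)).biUnion comp := by
      intro x hx
      obtain ⟨hxS, hxU⟩ := Finset.mem_sdiff.1 hx
      obtain ⟨z, h1, h2, h3⟩ := reach hu (hS u (hU hu) x hxS) hxU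
      exact Finset.mem_biUnion.2 ⟨z, Finset.mem_inter.2 ⟨h1, h2⟩, Finset.mem_filter.2 ⟨hx, h3⟩⟩
    have h1 := Finset.card_le_card hsub
    have h2 := Finset.card_biUnion_le_card_mul ((nbs U \ U) ∩ (S \ U)) comp 4
      (fun z hz => hcomp z (Finset.mem_inter.1 hz).2)
    have h3 := Finset.card_le_card (Finset.inter_subset_left (s₁ := nbs U \ U) (s₂ := S \ U))
    have h4 := Finset.card_sdiff_add_card_eq_card (subset_nbs U)
    omega
  have hcard := Finset.card_sdiff_add_card_eq_card hU
  have himg : (S.image (blockProj ℓ)).card ≤ 4 * k + (S \ U).card := by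
    have : S.image (blockProj ℓ) = U.image (blockProj ℓ) ∪ (S \ U).image (blockProj ℓ) := by
      rw [← Finset.image_union, Finset.union_sdiff_of_subset hU]
    rw [this]
    have h1 := Finset.card_union_le (U.image (blockProj ℓ)) ((S \ U).image (blockProj ℓ))
    have h2 := Finset.card_image_le (s := S \ U) (f := blockProj ℓ)
    omega
  omega

end KingAux

/-- There exists `ℓ₀ ≥ 2` such that for every `ℓ ≥ ℓ₀` and every finite `S ⊆ ℤ²`
connected in the king graph with `|S| ≥ 5`, one has `|π_ℓ(S)| ≤ |S| / (1 + 1/101)`. -/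
theorem stmt0 :
    ∃ ℓ₀ : ℤ, 2 ≤ ℓ₀ ∧
      ∀ ℓ : ℤ, ℓ₀ ≤ ℓ →
        ∀ S : Finset (ℤ × ℤ), kingConnected S → 5 ≤ S.card →
          ((S.image (blockProj ℓ)).card : ℝ) ≤ (S.card : ℝ) / (1 + 1 / 101) := by
  refine ⟨4, by norm_num, fun ℓ hℓ S hS h5 => ?_⟩
  have h : (102 : ℝ) * ((S.image (blockProj ℓ)).card : ℝ) ≤ 101 * (S.card : ℝ) := by
    exact_mod_cast KingAux.main hℓ hS h5
  rw [le_div_iff₀ (by norm_num)]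
  linarith
end

section
/- There is a constant C > 0 such that for every polymer X ⊂ ℝ² and every function f of class C² on a neighborhood of X: sup_{x∈X} |f(x)|² ≤ C · ( ∫_X |f|² + ∫_X |∇f|² + ∫_X |∇²f|² ). -/
open MeasureTheory

noncomputable section

/-- The plane, with its Euclidean structure. -/
abbrev E2 := EuclideanSpace ℝ (Fin 2)

/-- The closed unit square (block) of the standard tessellation of `ℝ²` with lower-left
corner `p ∈ ℤ²`. -/
def unitSquare (p : ℤ × ℤ) : Set E2 :=
  {x | (p.1 : ℝ) ≤ x 0 ∧ x 0 ≤ (p.1 : ℝ) + 1 ∧ (p.2 : ℝ) ≤ x 1 ∧ x 1 ≤ (p.2 : ℝ) + 1}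

/-- The polymer (finite union of closed unit squares) indexed by a finite set `S ⊆ ℤ²`. -/
def polymerOf (S : Finset (ℤ × ℤ)) : Set E2 := ⋃ p ∈ S, unitSquare p

/-- `‖∇ⁿf(x)‖`, the norm of the `n`-th derivative of `f` at `x`. -/
def dNorm (n : ℕ) (f : E2 → ℝ) (x : E2) : ℝ := ‖iteratedFDeriv ℝ n f x‖

lemma one_d (g g' : ℝ → ℝ) (a t : ℝ) (ht : t ∈ Set.Icc a (a+1))
    (h : ∀ s ∈ Set.Icc a (a+1), HasDerivAt g (g' s) s)
    (hc : ContinuousOn g' (Set.Icc a (a+1))) :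
    g t ^ 2 ≤ 2 * ∫ s in Set.Icc a (a+1), (g s ^ 2 + g' s ^ 2) := by
  have hg : ContinuousOn g (Set.Icc a (a+1)) := fun s hs => (h s hs).continuousAt.continuousWithinAt
  have hint : IntegrableOn (fun s => g s ^ 2 + g' s ^ 2) (Set.Icc a (a+1)) :=
    (ContinuousOn.integrableOn_Icc (by fun_prop))
  have hint2 : IntegrableOn (fun s => g s ^ 2) (Set.Icc a (a+1)) :=
    (ContinuousOn.integrableOn_Icc (by fun_prop))
  set J := ∫ s in Set.Icc a (a+1), (g s ^ 2 + g' s ^ 2) with hJ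
  have key : ∀ s ∈ Set.Icc a (a+1), g t ^ 2 ≤ g s ^ 2 + J := by
    intro s hs
    have hsub : Set.uIcc s t ⊆ Set.Icc a (a+1) := Set.uIcc_subset_Icc hs ht
    have hd : ∫ u in s..t, (2 * g u * g' u) = g t ^ 2 - g s ^ 2 := by
      apply intervalIntegral.integral_eq_sub_of_hasDerivAt (f := fun u => g u ^ 2)
      · intro u hu
        simpa using (h u (hsub hu)).fun_pow 2
      · apply ContinuousOn.intervalIntegrable
        have := hg.mono hsub
        have := hc.mono hsub
        fun_prop
    have h1 := intervalIntegral.norm_integral_le_integral_norm_uIoc (f := fun u => 2 * g u * g' u) (a := s) (b := t) (μ := volume)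
    have hsub' : Set.uIoc s t ⊆ Set.Icc a (a+1) := Set.uIoc_subset_uIcc.trans hsub
    have h2 : ∫ u in Set.uIoc s t, ‖2 * g u * g' u‖ ≤ ∫ u in Set.uIoc s t, (g u ^ 2 + g' u ^ 2) := by
      apply integral_mono_of_nonneg
      · exact Filter.Eventually.of_forall fun u => norm_nonneg _
      · exact hint.mono_set hsub'
      · refine Filter.Eventually.of_forall fun u => ?_
        simp only [Real.norm_eq_abs]
        apply abs_le.2
        constructor <;> nlinarith [sq_nonneg (g u - g' u), sq_nonneg (g u + g' u)]
    have h3 : ∫ u in Set.uIoc s t, (g u ^ 2 + g' u ^ 2) ≤ J := by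
      apply setIntegral_mono_set hint
      · exact Filter.Eventually.of_forall fun u => by positivity
      · exact hsub'.eventuallyLE
    rw [hd, Real.norm_eq_abs] at h1
    linarith [le_abs_self (g t ^ 2 - g s ^ 2)]
  have h4 : ∫ s in Set.Icc a (a+1), g t ^ 2 ≤ ∫ s in Set.Icc a (a+1), (g s ^ 2 + J) := by
    apply setIntegral_mono_on _ _ measurableSet_Icc key
    · exact integrableOn_const (by simp)
    · exact hint2.add (integrableOn_const (by simp))
  rw [integral_add hint2 (integrableOn_const (by simp))] at h4
  have h5 : ∫ s in Set.Icc a (a+1), g s ^ 2 ≤ J := by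
    apply setIntegral_mono_on hint2 hint measurableSet_Icc
    intro s _
    nlinarith [sq_nonneg (g' s)]
  simp at h4
  linarith

def PP (a b : ℝ) : E2 := !₂[a, b]
def e0 : E2 := EuclideanSpace.single 0 1
def e1 : E2 := EuclideanSpace.single 1 1

lemma PP_eq (a b : ℝ) : PP a b = a • e0 + b • e1 := by
  ext i
  fin_cases i <;> simp [PP, e0, e1]

lemma norm_e0 : ‖e0‖ = 1 := by simp [e0]
lemma norm_e1 : ‖e1‖ = 1 := by simp [e1]

lemma PP_deriv0 (a b : ℝ) : HasDerivAt (fun s => PP s b) e0 a := by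
  simp only [PP_eq]
  simpa using ((hasDerivAt_id a).smul_const e0).add_const (b • e1)

lemma PP_deriv1 (a b : ℝ) : HasDerivAt (fun s => PP a s) e1 b := by
  simp only [PP_eq]
  simpa using ((hasDerivAt_id b).smul_const e1).const_add (a • e0)

lemma PP_cont : Continuous (fun z : ℝ × ℝ => PP z.1 z.2) := by
  simp only [PP_eq]
  fun_prop

lemma PP_mp : MeasurePreserving (fun z : ℝ × ℝ => PP z.1 z.2) :=
  (PiLp.volume_preserving_toLp (Fin 2)).comp ((volume_preserving_finTwoArrow ℝ).symm _)

lemma PP_emb : MeasurableEmbedding (fun z : ℝ × ℝ => PP z.1 z.2) :=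
  (MeasurableEquiv.toLp 2 (Fin 2 → ℝ)).measurableEmbedding.comp
    (MeasurableEquiv.finTwoArrow (α := ℝ)).symm.measurableEmbedding

lemma PP_preimage (p : ℤ × ℤ) : (fun z : ℝ × ℝ => PP z.1 z.2) ⁻¹' unitSquare p =
    Set.Icc (p.1 : ℝ) (p.1 + 1) ×ˢ Set.Icc (p.2 : ℝ) (p.2 + 1) := by
  ext z
  simp only [unitSquare, PP, Set.mem_preimage, Set.mem_setOf_eq, Set.mem_prod, Set.mem_Icc]
  simp [and_assoc]

lemma PP_surj (x : E2) : PP (x 0) (x 1) = x := by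
  ext i
  fin_cases i <;> simp [PP]

lemma square_image (p : ℤ × ℤ) : unitSquare p = (fun z : ℝ × ℝ => PP z.1 z.2) ''
    (Set.Icc (p.1 : ℝ) (p.1 + 1) ×ˢ Set.Icc (p.2 : ℝ) (p.2 + 1)) := by
  rw [← PP_preimage, Set.image_preimage_eq]
  intro x
  exact ⟨(x 0, x 1), PP_surj x⟩

lemma square_compact (p : ℤ × ℤ) : IsCompact (unitSquare p) := by
  rw [square_image]
  exact (isCompact_Icc.prod isCompact_Icc).image PP_cont

lemma polymer_compact (S : Finset (ℤ × ℤ)) : IsCompact (polymerOf S) :=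
  S.isCompact_biUnion fun p _ => square_compact p

lemma dNorm_cont (n : ℕ) (hn : n ≤ 2) (f : E2 → ℝ) (U : Set E2) (hU : IsOpen U)
    (hf : ContDiffOn ℝ 2 f U) : ContinuousOn (dNorm n f) U := by
  have h := hf.continuousOn_iteratedFDerivWithin (m := n) (by exact_mod_cast hn) hU.uniqueDiffOn
  exact (h.congr fun x hx => (iteratedFDerivWithin_of_isOpen n hU hx).symm).norm

lemma square_bound (p : ℤ × ℤ) (f : E2 → ℝ) (U : Set E2) (hU : IsOpen U) (hp : unitSquare p ⊆ U)
    (hf : ContDiffOn ℝ 2 f U) (x : E2) (hx : x ∈ unitSquare p) :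
    f x ^ 2 ≤ 4 * ∫ y in unitSquare p, (f y ^ 2 + 2 * dNorm 1 f y ^ 2 + dNorm 2 f y ^ 2) := by
  set H : E2 → ℝ := fun y => f y ^ 2 + 2 * dNorm 1 f y ^ 2 + dNorm 2 f y ^ 2 with hH
  have hfd : ContDiffOn ℝ 1 (fderiv ℝ f) U := hf.fderiv_of_isOpen hU (by norm_num)
  have hfdd : ContinuousOn (fderiv ℝ (fderiv ℝ f)) U :=
    (hfd.fderiv_of_isOpen (m := 0) hU (by norm_num)).continuousOn
  have hc0 := hf.continuousOn
  have hc1 := hfd.continuousOn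
  have hd1 := dNorm_cont 1 (by norm_num) f U hU hf
  have hd2 := dNorm_cont 2 (by norm_num) f U hU hf
  have hHc : ContinuousOn H U := by fun_prop
  have hfder : ∀ z ∈ U, HasFDerivAt f (fderiv ℝ f z) z := fun z hz =>
    ((hf.contDiffAt (hU.mem_nhds hz)).differentiableAt (by norm_num)).hasFDerivAt
  have hfder2 : ∀ z ∈ U, HasFDerivAt (fderiv ℝ f) (fderiv ℝ (fderiv ℝ f) z) z := fun z hz =>
    ((hfd.contDiffAt (hU.mem_nhds hz)).differentiableAt (by norm_num)).hasFDerivAt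
  have hbd : ∀ z, f z ^ 2 + (fderiv ℝ f z e1) ^ 2 + ((fderiv ℝ f z e0) ^ 2
      + (fderiv ℝ (fderiv ℝ f) z e1 e0) ^ 2) ≤ H z := by
    intro z
    have b1 : ∀ e : E2, ‖e‖ = 1 → (fderiv ℝ f z e) ^ 2 ≤ dNorm 1 f z ^ 2 := by
      intro e he
      rw [sq_le_sq, dNorm, norm_iteratedFDeriv_one, abs_of_nonneg (norm_nonneg _)]
      simpa [he] using (fderiv ℝ f z).le_opNorm e
    have b2 : (fderiv ℝ (fderiv ℝ f) z e1 e0) ^ 2 ≤ dNorm 2 f z ^ 2 := by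
      rw [sq_le_sq, dNorm, abs_of_nonneg (norm_nonneg _)]
      have := (iteratedFDeriv ℝ 2 f z).le_opNorm ![e1, e0]
      rw [iteratedFDeriv_two_apply] at this
      simpa [norm_e0, norm_e1] using this
    simp only [hH]
    linarith [b1 e0 norm_e0, b1 e1 norm_e1]
  set I := Set.Icc (p.1 : ℝ) (p.1 + 1) with hI
  set J := Set.Icc (p.2 : ℝ) (p.2 + 1) with hJ
  have hmem : ∀ s ∈ I, ∀ t ∈ J, PP s t ∈ U := by
    intro s hs t ht
    apply hp
    rw [square_image]
    exact ⟨(s, t), ⟨hs, ht⟩, rfl⟩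
  have hx0 : x 0 ∈ I := ⟨hx.1, hx.2.1⟩
  have hx1 : x 1 ∈ J := ⟨hx.2.2.1, hx.2.2.2⟩
  have P0 : ∀ t, Continuous fun s => PP s t := fun t => PP_cont.comp (by fun_prop : Continuous fun s : ℝ => (s, t))
  have P1 : ∀ s, Continuous fun t => PP s t := fun s => PP_cont.comp (by fun_prop : Continuous fun t : ℝ => (s, t))
  have hHP : ContinuousOn (fun z : ℝ × ℝ => H (PP z.1 z.2)) (I ×ˢ J) :=
    hHc.comp PP_cont.continuousOn fun z hz => hmem _ hz.1 _ hz.2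
  have hHi : IntegrableOn (fun z : ℝ × ℝ => H (PP z.1 z.2)) (I ×ˢ J) (volume.prod volume) :=
    hHP.integrableOn_compact (isCompact_Icc.prod isCompact_Icc)
  -- vertical step
  have hvert : ∀ s ∈ I, f (PP s (x 1)) ^ 2 + (fderiv ℝ f (PP s (x 1)) e0) ^ 2 ≤
      2 * ∫ t in J, H (PP s t) := by
    intro s hs
    have m : Set.MapsTo (fun t => PP s t) J U := fun t ht => hmem s hs t ht
    have c0 : ContinuousOn (fun t => f (PP s t)) J := hc0.comp (P1 s).continuousOn m
    have cF : ContinuousOn (fun t => fderiv ℝ f (PP s t)) J := hc1.comp (P1 s).continuousOn m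
    have cFF : ContinuousOn (fun t => fderiv ℝ (fderiv ℝ f) (PP s t)) J :=
      hfdd.comp (P1 s).continuousOn m
    have cH : ContinuousOn (fun t => H (PP s t)) J := hHc.comp (P1 s).continuousOn m
    have c1 : ContinuousOn (fun t => fderiv ℝ f (PP s t) e1) J := cF.clm_apply continuousOn_const
    have c2 : ContinuousOn (fun t => fderiv ℝ f (PP s t) e0) J := cF.clm_apply continuousOn_const
    have c3 : ContinuousOn (fun t => fderiv ℝ (fderiv ℝ f) (PP s t) e1 e0) J :=
      (cFF.clm_apply continuousOn_const).clm_apply continuousOn_const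
    have k1 := one_d (fun t => f (PP s t)) (fun t => fderiv ℝ f (PP s t) e1) p.2 (x 1) hx1
      (fun t ht => (hfder _ (hmem s hs t ht)).comp_hasDerivAt t (PP_deriv1 s t)) c1
    have k2 := one_d (fun t => fderiv ℝ f (PP s t) e0)
      (fun t => fderiv ℝ (fderiv ℝ f) (PP s t) e1 e0) p.2 (x 1) hx1
      (fun t ht => by
        have := (hfder2 _ (hmem s hs t ht)).comp_hasDerivAt t (PP_deriv1 s t)
        simpa using this.clm_apply (hasDerivAt_const t e0)) c3
    have i1 : IntegrableOn (fun t => f (PP s t) ^ 2 + (fderiv ℝ f (PP s t) e1) ^ 2) J :=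
      ((c0.pow 2).add (c1.pow 2)).integrableOn_Icc
    have i2 : IntegrableOn (fun t => (fderiv ℝ f (PP s t) e0) ^ 2
        + (fderiv ℝ (fderiv ℝ f) (PP s t) e1 e0) ^ 2) J :=
      ((c2.pow 2).add (c3.pow 2)).integrableOn_Icc
    have k3 : ∫ t in J, ((f (PP s t) ^ 2 + (fderiv ℝ f (PP s t) e1) ^ 2) +
        ((fderiv ℝ f (PP s t) e0) ^ 2 + (fderiv ℝ (fderiv ℝ f) (PP s t) e1 e0) ^ 2)) ≤
        ∫ t in J, H (PP s t) :=
      setIntegral_mono_on (i1.add i2) cH.integrableOn_Icc measurableSet_Icc fun t _ => hbd _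
    rw [integral_add i1 i2] at k3
    linarith
  -- horizontal step
  have m : Set.MapsTo (fun s => PP s (x 1)) I U := fun s hs => hmem s hs _ hx1
  have c0 : ContinuousOn (fun s => f (PP s (x 1))) I := hc0.comp (P0 _).continuousOn m
  have cF : ContinuousOn (fun s => fderiv ℝ f (PP s (x 1))) I := hc1.comp (P0 _).continuousOn m
  have c1 : ContinuousOn (fun s => fderiv ℝ f (PP s (x 1)) e0) I := cF.clm_apply continuousOn_const
  have k1 := one_d (fun s => f (PP s (x 1))) (fun s => fderiv ℝ f (PP s (x 1)) e0) p.1 (x 0) hx0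
      (fun s hs => (hfder _ (m hs)).comp_hasDerivAt s (PP_deriv0 s _)) c1
  simp only [PP_surj] at k1
  have hHi' : IntegrableOn (fun s => ∫ t in J, H (PP s t)) I := by
    rw [IntegrableOn, ← Measure.prod_restrict] at hHi
    exact hHi.integral_prod_left
  have k2 : ∫ s in I, (f (PP s (x 1)) ^ 2 + (fderiv ℝ f (PP s (x 1)) e0) ^ 2) ≤
      ∫ s in I, 2 * ∫ t in J, H (PP s t) :=
    setIntegral_mono_on ((c0.pow 2).add (c1.pow 2)).integrableOn_Icc (hHi'.const_mul 2)
      measurableSet_Icc hvert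
  rw [integral_const_mul] at k2
  have k3 : ∫ s in I, ∫ t in J, H (PP s t) = ∫ y in unitSquare p, H y := by
    rw [← PP_mp.setIntegral_preimage_emb PP_emb, PP_preimage]
    exact (setIntegral_prod _ hHi).symm
  linarith

/-- There is a constant `C > 0` such that for every polymer `X ⊆ ℝ²` and every `f` of
class `C²` on a neighborhood of `X`:
`sup_{x ∈ X} |f(x)|² ≤ C (∫_X |f|² + ∫_X |∇f|² + ∫_X |∇²f|²)`. -/
theorem stmt2 :
    ∃ C : ℝ, 0 < C ∧
      ∀ S : Finset (ℤ × ℤ), S.Nonempty →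
        ∀ (f : E2 → ℝ) (U : Set E2), IsOpen U → polymerOf S ⊆ U →
          ContDiffOn ℝ 2 f U →
          ∀ x ∈ polymerOf S,
            f x ^ 2 ≤
              C * ((∫ y in polymerOf S, f y ^ 2) +
                   (∫ y in polymerOf S, dNorm 1 f y ^ 2) +
                   (∫ y in polymerOf S, dNorm 2 f y ^ 2)) := by
  refine ⟨8, by norm_num, ?_⟩
  intro S _ f U hU hSU hf x hx
  obtain ⟨p, hp, hxp⟩ : ∃ p ∈ S, x ∈ unitSquare p := by simpa [polymerOf] using hx
  have hpS : unitSquare p ⊆ polymerOf S := Set.subset_biUnion_of_mem (u := unitSquare) hp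
  have h1 := square_bound p f U hU (hpS.trans hSU) hf x hxp
  have hK := polymer_compact S
  have c0 := hf.continuousOn.mono hSU
  have c1 := (dNorm_cont 1 (by norm_num) f U hU hf).mono hSU
  have c2 := (dNorm_cont 2 (by norm_num) f U hU hf).mono hSU
  have i0 : IntegrableOn (fun y => f y ^ 2) (polymerOf S) := (c0.pow 2).integrableOn_compact hK
  have i1 : IntegrableOn (fun y => dNorm 1 f y ^ 2) (polymerOf S) :=
    (c1.pow 2).integrableOn_compact hK
  have i2 : IntegrableOn (fun y => dNorm 2 f y ^ 2) (polymerOf S) :=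
    (c2.pow 2).integrableOn_compact hK
  have i01 : IntegrableOn (fun y => f y ^ 2 + 2 * dNorm 1 f y ^ 2) (polymerOf S) :=
    i0.add (i1.const_mul 2)
  have h2 : ∫ y in unitSquare p, (f y ^ 2 + 2 * dNorm 1 f y ^ 2 + dNorm 2 f y ^ 2) ≤
      ∫ y in polymerOf S, (f y ^ 2 + 2 * dNorm 1 f y ^ 2 + dNorm 2 f y ^ 2) := by
    apply setIntegral_mono_set (i01.add i2)
    · exact Filter.Eventually.of_forall fun y => by
        change (0 : ℝ) ≤ f y ^ 2 + 2 * dNorm 1 f y ^ 2 + dNorm 2 f y ^ 2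
        positivity
    · exact hpS.eventuallyLE
  rw [integral_add i01 i2, integral_add i0 (i1.const_mul 2), integral_const_mul] at h2
  have n0 : 0 ≤ ∫ y in polymerOf S, f y ^ 2 := integral_nonneg fun y => sq_nonneg _
  have n2 : 0 ≤ ∫ y in polymerOf S, dNorm 2 f y ^ 2 := integral_nonneg fun y => sq_nonneg _
  linarith

end
end

section
/- Let X ⊂ ℝ² be compact, let D > 0 be such that any two points of X are joined by a rectifiable path contained in X of length at most D, and let Y ⊆ X be Lebesgue measurable with measure |Y| > 0. Then for every function f of class C¹ on a neighborhood of X: sup_{x∈X} |f(x)|² ≤ (2/|Y|) · ∫_Y |f|² + 2D² · sup_{x∈X} |∇f(x)|². -/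
open MeasureTheory

noncomputable section

theorem aux_lip (X : Set E2) (f : E2 → ℝ) (U : Set E2) (hU : IsOpen U) (hXU : X ⊆ U)
    (hf : ContDiffOn ℝ 1 f U) (C : NNReal) (hC : ∀ z ∈ X, ‖fderiv ℝ f z‖₊ < C)
    (γ : ℝ → E2) (hγ : ContinuousOn γ (Set.Icc 0 1)) (hγX : γ '' Set.Icc 0 1 ⊆ X) :
    edist (f (γ 0)) (f (γ 1)) ≤ C * eVariationOn γ (Set.Icc 0 1) := by
  have hcont : ContinuousOn (fderiv ℝ f) U := hf.continuousOn_fderiv_of_isOpen hU le_rfl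
  have hball : ∀ z : X, ∃ r > 0, LipschitzOnWith C f (Metric.ball (z : E2) r) := by
    rintro ⟨z, hz⟩
    have h1 : ∀ᶠ w in nhds z, ‖fderiv ℝ f w‖₊ < C := by
      have := (hcont.continuousAt (hU.mem_nhds (hXU hz))).nnnorm
      exact this.eventually (gt_mem_nhds (hC z hz))
    have h2 : ∀ᶠ w in nhds z, w ∈ U := hU.mem_nhds (hXU hz)
    obtain ⟨r, hr, h⟩ := Metric.eventually_nhds_iff_ball.1 (h1.and h2)
    refine ⟨r, hr, (convex_ball z r).lipschitzOnWith_of_nnnorm_fderiv_le (𝕜 := ℝ) ?_ ?_⟩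
    · intro w hw
      exact (hf.differentiableOn one_ne_zero).differentiableAt (hU.mem_nhds (h w hw).2)
    · intro w hw
      exact (h w hw).1.le
  choose r hr hlip using hball
  have hγ' : Continuous (fun t : Set.Icc (0:ℝ) 1 => γ t) := hγ.domRestrict
  obtain ⟨t, ht0, htm, ⟨m, htm1⟩, htc⟩ := exists_monotone_Icc_subset_open_cover_Icc
    (zero_le_one' ℝ) (c := fun z : X => (fun t : Set.Icc (0:ℝ) 1 => γ t) ⁻¹' Metric.ball (z : E2) (r z))
    (fun z => Metric.isOpen_ball.preimage hγ') (by
      intro s _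
      exact Set.mem_iUnion.2 ⟨⟨γ s, hγX ⟨s, s.2, rfl⟩⟩, Metric.mem_ball_self (hr _)⟩)
  have key : ∀ n, edist (f (γ 0)) (f (γ (t n))) ≤ C * eVariationOn γ (Set.Icc 0 (t n : ℝ)) := by
    intro n
    induction n with
    | zero => simp [ht0]
    | succ n ih =>
      have hle : (t n : ℝ) ≤ t (n+1) := htm (Nat.le_succ n)
      obtain ⟨z, hz⟩ := htc n
      have hstep : edist (f (γ (t n))) (f (γ (t (n+1)))) ≤
          C * eVariationOn γ (Set.Icc (t n : ℝ) (t (n+1))) := by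
        refine (hlip z (hz (Set.left_mem_Icc.2 hle)) (hz (Set.right_mem_Icc.2 hle))).trans ?_
        gcongr
        exact eVariationOn.edist_le _ (Set.left_mem_Icc.2 hle) (Set.right_mem_Icc.2 hle)
      have hadd := eVariationOn.Icc_add_Icc γ (s := Set.univ) (t n).2.1 hle (Set.mem_univ _)
      simp only [Set.univ_inter] at hadd
      rw [← hadd, mul_add]
      exact (edist_triangle _ _ _).trans (add_le_add ih hstep)
  have := key m
  rwa [htm1 m le_rfl] at this

/-- Let `X ⊂ ℝ²` be compact such that any two points of `X` are joined by a rectifiable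
path inside `X` of length at most `D`, and `Y ⊆ X` measurable of positive measure. Then
for `f` of class `C¹` on a neighborhood of `X`:
`sup_X |f|² ≤ (2/|Y|) ∫_Y |f|² + 2 D² sup_X |∇f|²`. -/
theorem stmt3 (X : Set E2) (hX : IsCompact X) (D : ℝ) (hD : 0 < D)
    (hpath : ∀ x ∈ X, ∀ y ∈ X, ∃ γ : ℝ → E2,
      ContinuousOn γ (Set.Icc 0 1) ∧ γ 0 = x ∧ γ 1 = y ∧
      γ '' Set.Icc 0 1 ⊆ X ∧ eVariationOn γ (Set.Icc 0 1) ≤ ENNReal.ofReal D)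
    (Y : Set E2) (hYX : Y ⊆ X) (hYm : MeasurableSet Y) (hY : 0 < (volume Y).toReal)
    (f : E2 → ℝ) (U : Set E2) (hU : IsOpen U) (hXU : X ⊆ U) (hf : ContDiffOn ℝ 1 f U) :
    ∀ x ∈ X,
      f x ^ 2 ≤
        2 / (volume Y).toReal * (∫ y in Y, f y ^ 2) +
          2 * D ^ 2 * ⨆ z ∈ X, ‖fderiv ℝ f z‖ ^ 2 := by
  intro x hx
  set S := ⨆ z ∈ X, ‖fderiv ℝ f z‖ ^ 2 with hS
  have hcont : ContinuousOn (fderiv ℝ f) X :=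
    (hf.continuousOn_fderiv_of_isOpen hU le_rfl).mono hXU
  obtain ⟨B, hB⟩ := (hX.image_of_continuousOn (hcont.norm.pow 2)).bddAbove
  have hBz : ∀ z ∈ X, ‖fderiv ℝ f z‖ ^ 2 ≤ B := fun z hz => hB ⟨z, hz, rfl⟩
  have hB0 : 0 ≤ B := (sq_nonneg _).trans (hBz x hx)
  have hle : ∀ z ∈ X, ‖fderiv ℝ f z‖ ^ 2 ≤ S := by
    intro z hz
    have hb : BddAbove (Set.range fun z => ⨆ _ : z ∈ X, ‖fderiv ℝ f z‖ ^ 2) := by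
      refine ⟨B, ?_⟩
      rintro _ ⟨w, rfl⟩
      exact Real.iSup_le (fun hw => hBz w hw) hB0
    have := le_ciSup hb z
    simpa [hz] using this
  have hS0 : 0 ≤ S := (sq_nonneg _).trans (hle x hx)
  have hdist : ∀ y ∈ X, |f x - f y| ≤ Real.sqrt S * D := by
    intro y hy
    obtain ⟨γ, hγ, h0, h1, hγX, hv⟩ := hpath x hx y hy
    have hε : ∀ ε > 0, |f x - f y| ≤ Real.sqrt S * D + ε := by
      intro ε hε
      have hpos : 0 ≤ Real.sqrt S + ε / D := by positivity
      have h := aux_lip X f U hU hXU hf (Real.toNNReal (Real.sqrt S + ε / D)) (by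
        intro z hz
        rw [← NNReal.coe_lt_coe]
        have : ‖fderiv ℝ f z‖ ≤ Real.sqrt S := Real.le_sqrt_of_sq_le (hle z hz)
        have h2 : 0 < ε / D := by positivity
        simp only [coe_nnnorm, Real.coe_toNNReal _ hpos]
        linarith) γ hγ hγX
      rw [h0, h1] at h
      have h' := h.trans (mul_le_mul_right hv _)
      rw [edist_dist, ← ENNReal.ofReal_coe_nnreal, ← ENNReal.ofReal_mul (NNReal.coe_nonneg _),
        ENNReal.ofReal_le_ofReal_iff (by positivity), Real.dist_eq] at h'
      refine h'.trans (le_of_eq ?_)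
      simp only [Real.coe_toNNReal _ hpos]
      field_simp
    exact le_of_forall_pos_le_add hε
  have hpt : ∀ y ∈ Y, f x ^ 2 - 2 * D ^ 2 * S ≤ 2 * f y ^ 2 := by
    intro y hy
    have h := hdist y (hYX hy)
    have h2 : (f x - f y) ^ 2 ≤ S * D ^ 2 := by
      rw [← sq_abs]
      calc |f x - f y| ^ 2 ≤ (Real.sqrt S * D) ^ 2 := by gcongr
        _ = S * D ^ 2 := by rw [mul_pow, Real.sq_sqrt hS0]
    nlinarith [sq_nonneg (f x - 2 * f y)]
  have hfin : volume Y ≠ ⊤ := ((measure_mono hYX).trans_lt hX.measure_lt_top).ne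
  have hint : IntegrableOn (fun y => f y ^ 2) Y :=
    (((hf.continuousOn.mono hXU).pow 2).integrableOn_compact hX).mono_set hYX
  have hmono := setIntegral_mono_on (integrableOn_const (C := f x ^ 2 - 2 * D ^ 2 * S) hfin)
    (hint.const_mul 2) hYm hpt
  rw [setIntegral_const, integral_const_mul, smul_eq_mul, measureReal_def] at hmono
  have : f x ^ 2 - 2 * D ^ 2 * S ≤ 2 / (volume Y).toReal * (∫ y in Y, f y ^ 2) := by
    rw [div_mul_eq_mul_div, le_div_iff₀ hY]
    linarith
  linarith

end
end
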